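/- Let H be a bipartite graph with t vertices whose minimal vertex cover has size q ≥ 1, and let V_1,…,V_t be a partition of {1,…,n}. Let R' be the matrix with R'(A,B) = R_H(A,B) whenever A ∩ B = ∅, a_i ∈ V_i for all i ∈ [1,x], and b_j ∈ V_{x+j} for all j ∈ [1,y], and R'(A,B) = 0 otherwise. Then for all ε ∈ (0,1), the probability that ‖R'‖ ≥ (e·t·(ln(n^q/ε)/(2q) + 1))^q · n^{(t−q)/2} is at most ε. -/

import Mathlib

noncomputable def opNorm {α β : Type*} [Fintype α] [Fintype β] [DecidableEq β]
    (M : Matrix α β ℝ) : ℝ :=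
  ‖LinearMap.toContinuousLinearMap (Matrix.toEuclideanLin M)‖

def sgn (b : Bool) : ℝ := if b then 1 else -1

noncomputable def Pr {n : ℕ} (P : (Sym2 (Fin n) → Bool) → Prop) : ℝ := by
  classical
  exact ((Finset.univ.filter P).card : ℝ) / (Fintype.card (Sym2 (Fin n) → Bool))

noncomputable def Ex {n : ℕ} (f : (Sym2 (Fin n) → Bool) → ℝ) : ℝ :=
  (∑ g : Sym2 (Fin n) → Bool, f g) / (Fintype.card (Sym2 (Fin n) → Bool))

noncomputable def Rmat {n : ℕ} (g : Sym2 (Fin n) → Bool) : Matrix (Fin n) (Fin n) ℝ :=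
  Matrix.of fun i j => if i = j then 0 else sgn (g s(i, j))

def cyc {m : ℕ} (j : Fin m) : Fin m := ⟨((j : ℕ) + 1) % m, Nat.mod_lt _ j.pos⟩

abbrev SubsetsCard (n x : ℕ) := {A : Finset (Fin n) // A.card = x}

def tup {n x : ℕ} (A : SubsetsCard n x) (i : Fin x) : Fin n :=
  (A.1.orderIsoOfFin A.2 i : Fin n)

noncomputable def RH {n x y : ℕ} (E : Finset (Fin x × Fin y)) (g : Sym2 (Fin n) → Bool) :
    Matrix (SubsetsCard n x) (SubsetsCard n y) ℝ :=
  Matrix.of fun A B =>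
    if Disjoint A.1 B.1 then ∏ e ∈ E, sgn (g s(tup A e.1, tup B e.2)) else 0

def IsVertexCover {x y : ℕ} (E : Finset (Fin x × Fin y)) (S : Finset (Fin x ⊕ Fin y)) : Prop :=
  ∀ e ∈ E, Sum.inl e.1 ∈ S ∨ Sum.inr e.2 ∈ S

noncomputable def RHpart {n x y : ℕ} (E : Finset (Fin x × Fin y))
    (P : (Fin x ⊕ Fin y) → Finset (Fin n)) (g : Sym2 (Fin n) → Bool) :
    Matrix (SubsetsCard n x) (SubsetsCard n y) ℝ :=
  Matrix.of fun A B =>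
    if Disjoint A.1 B.1 ∧ (∀ i, tup A i ∈ P (Sum.inl i)) ∧ (∀ j, tup B j ∈ P (Sum.inr j))
    then RH E g A B else 0

open Finset

/-- A real square Hermitian positive semidefinite matrix satisfies `‖S‖ ^ k ≤ tr (S ^ k)`. -/
lemma opNorm_pow_le_trace {α : Type*} [Fintype α] [DecidableEq α] {S : Matrix α α ℝ}
    (hS : S.PosSemidef) {k : ℕ} (hk : k ≠ 0) : opNorm S ^ k ≤ (S ^ k).trace := by
  open scoped Matrix.Norms.L2Operator in
  set U := hS.1.eigenvectorUnitary
  set d := hS.1.eigenvalues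
  have hspec : S = (U : Matrix α α ℝ) * Matrix.diagonal d * star (U : Matrix α α ℝ) := by
    simpa [Unitary.conjStarAlgAut_apply] using hS.1.spectral_theorem
  have hpow : ∀ m : ℕ, S ^ m =
      (U : Matrix α α ℝ) * Matrix.diagonal (fun i => d i ^ m) * star (U : Matrix α α ℝ) := by
    intro m
    induction m with
    | zero => simp
    | succ m ih =>
      rw [pow_succ, ih]
      nth_rewrite 1 [hspec]
      have h1 : star (U : Matrix α α ℝ) * (U : Matrix α α ℝ) = 1 := by simp
      calc _ = (U : Matrix α α ℝ) * Matrix.diagonal (fun i => d i ^ m) *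
            (star (U : Matrix α α ℝ) * (U : Matrix α α ℝ)) * Matrix.diagonal d *
            star (U : Matrix α α ℝ) := by simp only [Matrix.mul_assoc]
        _ = _ := by
          rw [h1, mul_one, mul_assoc (U : Matrix α α ℝ), Matrix.diagonal_mul_diagonal]
          simp only [pow_succ]
  have htr : (S ^ k).trace = ∑ i, d i ^ k := by
    rw [hpow, Matrix.trace_mul_comm, ← mul_assoc]
    simp [Matrix.trace]
  have hnorm : opNorm S = ‖d‖ := by
    have h : ‖S‖ = ‖d‖ := by
      have h1 : ‖S‖ = ‖Matrix.diagonal d‖ := by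
        conv_lhs => rw [hspec]
        rw [← Unitary.coe_star, CStarRing.norm_mul_coe_unitary, CStarRing.norm_coe_unitary_mul]
      rw [h1, Matrix.l2_opNorm_diagonal]
    rw [← h]
    rfl
  have hd : ∀ i, 0 ≤ d i := hS.eigenvalues_nonneg
  rw [hnorm, htr]
  rcases isEmpty_or_nonempty α with hα | hα
  · rw [Subsingleton.elim d 0]
    simp [hk]
  · obtain ⟨i, hi⟩ := Finite.exists_max (fun i => ‖d i‖)
    have : ‖d‖ = d i := by
      rw [← Real.norm_of_nonneg (hd i)]
      exact le_antisymm ((pi_norm_le_iff_of_nonneg (norm_nonneg _)).2 hi) (norm_le_pi_norm d i)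
    rw [this]
    exact Finset.single_le_sum (f := fun i => d i ^ k) (fun i _ => pow_nonneg (hd i) k)
      (Finset.mem_univ i)

lemma opNorm_pow_two_mul_le_trace {α β : Type*} [Fintype α] [Fintype β] [DecidableEq α]
    [DecidableEq β] (M : Matrix α β ℝ) {k : ℕ} (hk : k ≠ 0) :
    opNorm M ^ (2 * k) ≤ ((M * M.transpose) ^ k).trace := by
  have h : opNorm (M * M.transpose) = opNorm M ^ 2 := by
    open scoped Matrix.Norms.L2Operator in
    have h1 := Matrix.l2_opNorm_conjTranspose_mul_self M.transpose
    have h2 := Matrix.l2_opNorm_conjTranspose M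
    rw [Matrix.conjTranspose_eq_transpose_of_trivial] at h1 h2
    rw [h2, Matrix.transpose_transpose] at h1
    rw [sq]
    exact h1
  rw [pow_mul, ← h]
  refine opNorm_pow_le_trace ?_ hk
  have := Matrix.posSemidef_self_mul_conjTranspose M
  rwa [Matrix.conjTranspose_eq_transpose_of_trivial] at this

lemma sum_path_prod {α : Type*} [Fintype α] [DecidableEq α] (S : Matrix α α ℝ) (m : ℕ)
    (f : α → α → ℝ) :
    ∑ p : Fin (m + 1) → α, f (p 0) (p (Fin.last m)) * ∏ r : Fin m, S (p r.castSucc) (p r.succ) =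
      ∑ i, ∑ j, f i j * (S ^ m) i j := by
  induction m generalizing f with
  | zero =>
    rw [← (Equiv.funUnique (Fin 1) α).symm.sum_comp]
    simp [Matrix.one_apply]
  | succ m ih =>
    rw [← (Fin.consEquiv fun _ => α).sum_comp, Fintype.sum_prod_type]
    calc _ = ∑ p : Fin (m + 1) → α, (∑ a, f a (p (Fin.last m)) * S a (p 0)) *
          ∏ r : Fin m, S (p r.castSucc) (p r.succ) := by
          rw [Finset.sum_comm]
          refine Finset.sum_congr rfl fun p _ => ?_
          rw [Finset.sum_mul]
          refine Finset.sum_congr rfl fun a _ => ?_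
          rw [Fin.prod_univ_succ, ← mul_assoc]
          simp [Fin.consEquiv, ← Fin.succ_last]
      _ = _ := by
          rw [ih (fun i j => ∑ a, f a j * S a i)]
          simp only [pow_succ', Matrix.mul_apply, Finset.sum_mul, Finset.mul_sum]
          rw [Finset.sum_comm]
          conv_rhs => rw [Finset.sum_comm]
          refine Finset.sum_congr rfl fun j _ => ?_
          rw [Finset.sum_comm]
          refine Finset.sum_congr rfl fun a _ => Finset.sum_congr rfl fun i _ => ?_
          ring

lemma trace_pow_eq_sum_cycle {α : Type*} [Fintype α] [DecidableEq α] (S : Matrix α α ℝ) (m : ℕ) :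
    (S ^ (m + 1)).trace = ∑ p : Fin (m + 1) → α, ∏ r, S (p r) (p (r + 1)) := by
  have h := sum_path_prod S m (fun i j => S j i)
  calc _ = ∑ i, ∑ j, S j i * (S ^ m) i j := by
        simp only [Matrix.trace, Matrix.diag, pow_succ, Matrix.mul_apply]
        exact Finset.sum_congr rfl fun i _ => Finset.sum_congr rfl fun j _ => mul_comm _ _
    _ = _ := by
        rw [← h]
        refine Finset.sum_congr rfl fun p _ => ?_
        rw [Fin.prod_univ_castSucc, mul_comm]
        simp

lemma trace_mul_transpose_pow {α β : Type*} [Fintype α] [Fintype β] [DecidableEq α]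
    (M : Matrix α β ℝ) (m : ℕ) :
    ((M * M.transpose) ^ (m + 1)).trace = ∑ A : Fin (m + 1) → α, ∑ B : Fin (m + 1) → β,
      ∏ r, M (A r) (B r) * M (A (r + 1)) (B r) := by
  rw [trace_pow_eq_sum_cycle]
  refine Finset.sum_congr rfl fun A _ => ?_
  simp only [Matrix.mul_apply, Matrix.transpose_apply]
  rw [Finset.prod_univ_sum]
  simp

lemma card_image_range_succ_le {α : Type*} [DecidableEq α] (w : ℕ → α) (m : ℕ) :
    #((range (m + 1)).image w) ≤ #((range m).image fun i => s(w i, w (i + 1))) + 1 := by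
  induction m with
  | zero => simp
  | succ m ih =>
    rw [range_add_one (n := m + 1), image_insert]
    have hedges : ((range (m + 1)).image fun i => s(w i, w (i + 1))) =
        insert s(w m, w (m + 1)) ((range m).image fun i => s(w i, w (i + 1))) := by
      rw [range_add_one, image_insert]
    rw [hedges]
    by_cases h : w (m + 1) ∈ (range (m + 1)).image w
    · rw [insert_eq_of_mem h]
      exact ih.trans (Nat.add_le_add_right (card_le_card (subset_insert _ _)) 1)
    · have h' : s(w m, w (m + 1)) ∉ (range m).image fun i => s(w i, w (i + 1)) := by
        intro hc
        obtain ⟨i, hi, hie⟩ := mem_image.1 hc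
        have hi := mem_range.1 hi
        have : w (m + 1) ∈ s(w i, w (i + 1)) := by
          rw [hie]
          exact Sym2.mem_mk_right _ _
        rcases Sym2.mem_iff.1 this with h1 | h1
        · exact h (mem_image.2 ⟨i, mem_range.2 (by omega), h1.symm⟩)
        · exact h (mem_image.2 ⟨i + 1, mem_range.2 (by omega), h1.symm⟩)
      rw [card_insert_of_notMem h, card_insert_of_notMem h']
      omega

/-- The edges of the closed walk `a 0, b 0, a 1, b 1, …`: the vertex `b r` is joined to `a r`
(`i = (r, false)`) and to `a (r + 1)` (`i = (r, true)`), cyclically. -/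
def walkEdge {α : Type*} {m : ℕ} (a b : Fin (m + 1) → α) (i : Fin (m + 1) × Bool) : Sym2 α :=
  s(a (if i.2 then i.1 + 1 else i.1), b i.1)

/-- A closed walk of length `2 (m + 1)` traversing every edge an even number of times visits at
most `m + 2` vertices. -/
lemma card_image_closedWalk_le {α : Type*} [DecidableEq α] {m : ℕ} (a b : Fin (m + 1) → α)
    (heven : ∀ z, Even #{i | walkEdge a b i = z}) :
    #(univ.image a ∪ univ.image b) ≤ m + 2 := by
  set D : Finset (Sym2 α) := univ.image (walkEdge a b)
  have hDcard : #D ≤ m + 1 := by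
    have h := mul_card_image_le_card_of_maps_to (f := walkEdge a b) (s := univ) (t := D)
      (fun i hi => mem_image_of_mem _ hi) 2 (by
      intro z hz
      obtain ⟨i, -, hi⟩ := mem_image.1 hz
      have hpos : 0 < #{i | walkEdge a b i = z} := card_pos.2 ⟨i, by simpa using hi⟩
      obtain ⟨c, hc⟩ := heven z
      omega)
    rw [card_univ, Fintype.card_prod, Fintype.card_fin, Fintype.card_bool] at h
    omega
  let w : ℕ → α := fun i => if i % 2 = 0 then a (Fin.ofNat (m + 1) (i / 2))
    else b (Fin.ofNat (m + 1) (i / 2))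
  have hw := card_image_range_succ_le w (2 * (m + 1))
  have hsub1 : univ.image a ∪ univ.image b ⊆ (range (2 * (m + 1) + 1)).image w := by
    intro v hv
    rcases mem_union.1 hv with hv | hv
    · obtain ⟨r, -, rfl⟩ := mem_image.1 hv
      exact mem_image.2 ⟨2 * r, mem_range.2 (by omega), by simp [w]⟩
    · obtain ⟨r, -, rfl⟩ := mem_image.1 hv
      refine mem_image.2 ⟨2 * r + 1, mem_range.2 (by omega), ?_⟩
      have : (2 * (r : ℕ) + 1) / 2 = r := by omega
      simp [w, this]
  have hsub2 : ((range (2 * (m + 1))).image fun i => s(w i, w (i + 1))) ⊆ D := by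
    intro z hz
    obtain ⟨i, hi, rfl⟩ := mem_image.1 hz
    have hi := mem_range.1 hi
    rcases Nat.even_or_odd' i with ⟨r, rfl | rfl⟩
    · have : (2 * r + 1) / 2 = r := by omega
      exact mem_image.2 ⟨(Fin.ofNat (m + 1) r, false), mem_univ _, by simp [w, walkEdge, this]⟩
    · have h1 : (2 * r + 1) / 2 = r := by omega
      have h2 : (2 * r + 1 + 1) / 2 = r + 1 := by omega
      have h3 : (2 * r + 1 + 1) % 2 = 0 := by omega
      have h4 : Fin.ofNat (m + 1) (r + 1) = Fin.ofNat (m + 1) r + 1 := by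
        ext; simp [Fin.ofNat, Fin.val_add]
      refine mem_image.2 ⟨(Fin.ofNat (m + 1) r, true), mem_univ _, ?_⟩
      simp only [w, walkEdge, h1, h2, h3, h4, if_true]
      rw [if_neg (by omega), Sym2.eq_swap]
  have := card_le_card hsub1
  have := card_le_card hsub2
  omega

lemma exists_comp_of_card_image_le {ι α : Type*} [Fintype ι] [DecidableEq α] [Nonempty α]
    {N : ℕ} (f : ι → α) (hf : #(univ.image f) ≤ N) :
    ∃ c : (Fin N → α) × (ι → Fin N), f = c.1 ∘ c.2 := by
  let e := (univ.image f).equivFin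
  let u : Fin N → α := fun i =>
    if h : (i : ℕ) < #(univ.image f) then (e.symm ⟨i, h⟩ : α) else Classical.arbitrary α
  refine ⟨(u, fun i => Fin.castLE hf (e ⟨f i, mem_image_of_mem f (mem_univ i)⟩)), ?_⟩
  funext i
  simp [u]

/-- The vertices on one side of a minimum vertex cover can be matched into the vertices outside the
cover on the other side. -/
lemma exists_injective_of_min_cover {X Y : Type*} [DecidableEq X] [Fintype Y] [DecidableEq Y]
    {r : X → Y → Prop} {L : Finset X} {R : Finset Y} (hcov : ∀ i j, r i j → i ∈ L ∨ j ∈ R)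
    (hmin : ∀ (L' : Finset X) (R' : Finset Y), (∀ i j, r i j → i ∈ L' ∨ j ∈ R') →
      #L + #R ≤ #L' + #R') :
    ∃ f : L → Y, Function.Injective f ∧ ∀ i : L, r i (f i) ∧ f i ∉ R := by
  classical
  suffices h : ∃ f : L → Y, Function.Injective f ∧
      ∀ i : L, f i ∈ univ.filter fun j => r i j ∧ j ∉ R by simpa using h
  rw [← Finset.all_card_le_biUnion_card_iff_exists_injective]
  intro T
  set N := T.biUnion fun i : L => univ.filter fun j => r i j ∧ j ∉ R
  have hT : T.map (Function.Embedding.subtype _) ⊆ L := by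
    intro v hv
    obtain ⟨i, -, rfl⟩ := mem_map.1 hv
    exact i.2
  have h1 := hmin (L \ T.map (Function.Embedding.subtype _)) (R ∪ N) (by
    intro i j hij
    by_cases hj : j ∈ R
    · exact Or.inr (mem_union_left _ hj)
    · have hi := (hcov i j hij).resolve_right hj
      by_cases hiT : (⟨i, hi⟩ : L) ∈ T
      · exact Or.inr (mem_union_right _ (mem_biUnion.2 ⟨_, hiT, by simpa using ⟨hij, hj⟩⟩))
      · refine Or.inl (mem_sdiff.2 ⟨hi, fun hc => hiT ?_⟩)
        obtain ⟨i', hi', rfl⟩ := mem_map.1 hc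
        exact hi')
  have h2 := card_union_le R N
  have h3 := card_sdiff_add_card_eq_card hT
  rw [card_map] at h3
  omega

/-- **König's theorem**, in the direction producing a matching as large as a minimum vertex
cover. -/
lemma exists_matching_of_isLeast_vertexCover {x y q : ℕ} (E : Finset (Fin x × Fin y))
    (hq : IsLeast {m | ∃ S : Finset (Fin x ⊕ Fin y), IsVertexCover E S ∧ S.card = m} q) :
    ∃ (μ : Fin q → Fin x) (ν : Fin q → Fin y), Function.Injective μ ∧ Function.Injective ν ∧
      ∀ s, (μ s, ν s) ∈ E := by
  obtain ⟨⟨S, hS, hcard⟩, hmin⟩ := hq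
  have hcov : ∀ i j, (i, j) ∈ E → i ∈ S.toLeft ∨ j ∈ S.toRight := fun i j hij => by
    simpa using hS (i, j) hij
  have hSle : ∀ (L : Finset (Fin x)) (R : Finset (Fin y)),
      (∀ i j, (i, j) ∈ E → i ∈ L ∨ j ∈ R) → #S.toLeft + #S.toRight ≤ #L + #R := by
    intro L R h
    rw [card_toLeft_add_card_toRight, hcard, ← card_disjSum]
    exact hmin ⟨_, fun e he => by simpa using h e.1 e.2 he, rfl⟩
  obtain ⟨f, hfinj, hf⟩ := exists_injective_of_min_cover hcov hSle
  obtain ⟨h, hhinj, hh⟩ := exists_injective_of_min_cover (r := fun j i => (i, j) ∈ E)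
    (fun j i hij => (hcov i j hij).symm) (fun L R hLR => by
      have := hSle R L fun i j hij => (hLR j i hij).symm
      omega)
  let μ : S.toLeft ⊕ S.toRight → Fin x := Sum.elim Subtype.val h
  let ν : S.toLeft ⊕ S.toRight → Fin y := Sum.elim f Subtype.val
  have hμ : Function.Injective μ := Subtype.val_injective.sumElim hhinj
    fun i j hij => (hh j).2 (hij ▸ i.2)
  have hν : Function.Injective ν := hfinj.sumElim Subtype.val_injective
    fun i j hij => (hf i).2 (hij ▸ j.2)
  have e : Fin q ≃ S.toLeft ⊕ S.toRight := Fintype.equivOfCardEq (by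
    rw [Fintype.card_sum, Fintype.card_coe, Fintype.card_coe, card_toLeft_add_card_toRight, hcard,
      Fintype.card_fin])
  refine ⟨μ ∘ e, ν ∘ e, hμ.comp e.injective, hν.comp e.injective, fun s => ?_⟩
  simp only [Function.comp]
  rcases e s with i | j
  · exact (hf i).1
  · exact (hh j).1

lemma card_matched_trajectories_le {V : Type*} [Fintype V] [DecidableEq V] {n q k N : ℕ}
    (hn : 1 ≤ n) (μ ν : Fin q → V) (hinj : Function.Injective (Sum.elim μ ν)) :
    #{φ : V → Fin k → Fin n | ∀ s, #(univ.image (φ (μ s)) ∪ univ.image (φ (ν s))) ≤ N} ≤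
      (n ^ N * N ^ (2 * k)) ^ q * (n ^ k) ^ (Fintype.card V - 2 * q) := by
  classical
  have : Nonempty (Fin n) := ⟨⟨0, hn⟩⟩
  set F : Finset (V → Fin k → Fin n) :=
    {φ | ∀ s, #(univ.image (φ (μ s)) ∪ univ.image (φ (ν s))) ≤ N}
  have hcode : ∀ φ : F, ∃ c : Fin q → (Fin N → Fin n) × (Fin k ⊕ Fin k → Fin N),
      ∀ s, Sum.elim (φ.1 (μ s)) (φ.1 (ν s)) = (c s).1 ∘ (c s).2 := by
    intro φ
    refine Classical.skolem.1 fun s => exists_comp_of_card_image_le _ ?_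
    refine le_trans (card_le_card fun v hv => ?_) ((mem_filter.1 φ.2).2 s)
    obtain ⟨i | i, -, rfl⟩ := mem_image.1 hv
    · exact mem_union_left _ (mem_image_of_mem _ (mem_univ i))
    · exact mem_union_right _ (mem_image_of_mem _ (mem_univ i))
  choose code hcode using hcode
  let enc : F → (Fin q → (Fin N → Fin n) × (Fin k ⊕ Fin k → Fin N)) ×
      ({v // v ∉ Set.range (Sum.elim μ ν)} → Fin k → Fin n) := fun φ => (code φ, fun v => φ.1 v)
  have henc : Function.Injective enc := by
    intro φ ψ h
    have h1 : code φ = code ψ := congrArg Prod.fst h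
    have h2 := congrArg Prod.snd h
    have h3 : ∀ s, Sum.elim (φ.1 (μ s)) (φ.1 (ν s)) = Sum.elim (ψ.1 (μ s)) (ψ.1 (ν s)) :=
      fun s => by rw [hcode φ, hcode ψ, h1]
    refine Subtype.ext (funext fun v => ?_)
    by_cases hv : v ∈ Set.range (Sum.elim μ ν)
    · obtain ⟨s | s, rfl⟩ := hv
      · exact funext fun r => congrFun (h3 s) (Sum.inl r)
      · exact funext fun r => congrFun (h3 s) (Sum.inr r)
    · exact congrFun h2 ⟨v, hv⟩
  have hcard := Fintype.card_le_of_injective enc henc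
  have hcompl : Fintype.card {v // v ∉ Set.range (Sum.elim μ ν)} = Fintype.card V - 2 * q := by
    rw [Fintype.card_subtype_compl]
    have := Fintype.card_congr (Equiv.ofInjective _ hinj)
    rw [Fintype.card_sum, Fintype.card_fin] at this
    have h' : Fintype.card {v // v ∈ Set.range (Sum.elim μ ν)} = q + q := by
      rw [this]
    rw [h', two_mul]
  rw [Fintype.card_prod, Fintype.card_fun (α := {v // v ∉ Set.range (Sum.elim μ ν)}), hcompl]
    at hcard
  simpa [two_mul] using hcard

lemma abs_sgn (b : Bool) : |sgn b| = 1 := by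
  cases b <;> simp [sgn]

lemma sum_prod_sgn_eq_zero {β ι : Type*} [Fintype β] [DecidableEq β] (s : Finset ι) (p : ι → β)
    (z : β) (hodd : Odd #{i ∈ s | p i = z}) :
    ∑ g : β → Bool, ∏ i ∈ s, sgn (g (p i)) = 0 := by
  let flip : (β → Bool) → (β → Bool) := fun g => Function.update g z (!g z)
  have hflip : Function.Involutive flip := fun g => by simp [flip]
  have hterm : ∀ g : β → Bool, ∏ i ∈ s, sgn (flip g (p i)) = -∏ i ∈ s, sgn (g (p i)) := by
    intro g
    have h1 : ∀ i, sgn (flip g (p i)) = (if p i = z then -1 else 1) * sgn (g (p i)) := by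
      intro i
      by_cases h : p i = z
      · rw [h]
        cases hz : g z <;> simp [flip, sgn, hz]
      · simp [flip, h]
    simp only [h1]
    rw [prod_mul_distrib, prod_ite, prod_const, prod_const_one, hodd.neg_one_pow]
    ring
  have h := Equiv.sum_comp (Function.Involutive.toPerm flip hflip)
    fun g : β → Bool => ∏ i ∈ s, sgn (g (p i))
  simp only [Function.Involutive.coe_toPerm, hterm, sum_neg_distrib] at h
  linarith

lemma sum_prod_sgn_le {β ι : Type*} [Fintype β] [DecidableEq β] (s : Finset ι) (p : ι → β) :
    ∑ g : β → Bool, ∏ i ∈ s, sgn (g (p i)) ≤ Fintype.card (β → Bool) := by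
  calc _ ≤ ∑ _g : β → Bool, (1 : ℝ) := by
        refine sum_le_sum fun g _ => (le_abs_self _).trans ?_
        rw [abs_prod]
        simp [abs_sgn]
    _ = _ := by simp

/-- The sequences of vertices of `Fin n` assigned to each vertex of the bipartite graph by a
sequence of index pairs. -/
def trajectory {n x y k : ℕ} (AB : (Fin k → SubsetsCard n x) × (Fin k → SubsetsCard n y)) :
    Fin x ⊕ Fin y → Fin k → Fin n :=
  Sum.elim (fun i r => tup (AB.1 r) i) (fun j r => tup (AB.2 r) j)

lemma tup_injective {n x : ℕ} : Function.Injective (tup : SubsetsCard n x → Fin x → Fin n) := by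
  have himage : ∀ A : SubsetsCard n x, univ.image (tup A) = A.1 := fun A => by
    ext v
    constructor
    · intro hv
      obtain ⟨i, -, rfl⟩ := mem_image.1 hv
      exact (A.1.orderIsoOfFin A.2 i).2
    · intro hv
      exact mem_image.2 ⟨(A.1.orderIsoOfFin A.2).symm ⟨v, hv⟩, mem_univ _, by simp [tup]⟩
  intro A B h
  exact Subtype.ext (by rw [← himage A, ← himage B, h])

lemma trajectory_injective {n x y k : ℕ} :
    Function.Injective
      (trajectory : (Fin k → SubsetsCard n x) × (Fin k → SubsetsCard n y) → _) := by
  intro AB CD h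
  refine Prod.ext (funext fun r => tup_injective (funext fun i => ?_))
    (funext fun r => tup_injective (funext fun j => ?_))
  · exact congrFun (congrFun h (Sum.inl i)) r
  · exact congrFun (congrFun h (Sum.inr j)) r

/-- If the expected weight of a closed walk of index sets is nonzero, then every edge of the
bipartite graph traces out a closed walk visiting few vertices. -/
lemma sum_cycle_weight_le {n x y m : ℕ} (E : Finset (Fin x × Fin y))
    (P : (Fin x ⊕ Fin y) → Finset (Fin n)) (hP : ∀ a b, a ≠ b → Disjoint (P a) (P b))
    (AB : (Fin (m + 1) → SubsetsCard n x) × (Fin (m + 1) → SubsetsCard n y))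
    (e₀ : Fin x × Fin y) (he₀ : e₀ ∈ E) :
    ∑ g : Sym2 (Fin n) → Bool,
      ∏ r, RHpart E P g (AB.1 r) (AB.2 r) * RHpart E P g (AB.1 (r + 1)) (AB.2 r) ≤
      if #(univ.image (trajectory AB (Sum.inl e₀.1)) ∪ univ.image (trajectory AB (Sum.inr e₀.2))) ≤
        m + 2 then (Fintype.card (Sym2 (Fin n) → Bool) : ℝ) else 0 := by
  by_cases hplaced : ∀ r,
      (Disjoint (AB.1 r).1 (AB.2 r).1 ∧ (∀ i, tup (AB.1 r) i ∈ P (Sum.inl i)) ∧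
        ∀ j, tup (AB.2 r) j ∈ P (Sum.inr j)) ∧
      (Disjoint (AB.1 (r + 1)).1 (AB.2 r).1 ∧ (∀ i, tup (AB.1 (r + 1)) i ∈ P (Sum.inl i)) ∧
        ∀ j, tup (AB.2 r) j ∈ P (Sum.inr j))
  swap
  · obtain ⟨r, hr⟩ := not_forall.1 hplaced
    have hzero : ∀ g : Sym2 (Fin n) → Bool,
        ∏ r, RHpart E P g (AB.1 r) (AB.2 r) * RHpart E P g (AB.1 (r + 1)) (AB.2 r) = 0 := by
      intro g
      refine prod_eq_zero (mem_univ r) ?_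
      rcases not_and_or.1 hr with h | h
      · exact mul_eq_zero_of_left (by rw [RHpart, Matrix.of_apply, if_neg h]) _
      · exact mul_eq_zero_of_right _ (by rw [RHpart, Matrix.of_apply, if_neg h])
    simp only [hzero, sum_const_zero]
    split_ifs <;> positivity
  -- the index set of all signs occurring in the product, and the pair each of them is read from
  let I : Finset ((Fin (m + 1) × Bool) × (Fin x × Fin y)) := univ ×ˢ E
  let p : (Fin (m + 1) × Bool) × (Fin x × Fin y) → Sym2 (Fin n) := fun t =>
    walkEdge (trajectory AB (Sum.inl t.2.1)) (trajectory AB (Sum.inr t.2.2)) t.1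
  have hprod : ∀ g : Sym2 (Fin n) → Bool,
      ∏ r, RHpart E P g (AB.1 r) (AB.2 r) * RHpart E P g (AB.1 (r + 1)) (AB.2 r) =
      ∏ t ∈ I, sgn (g (p t)) := by
    intro g
    rw [prod_product, Fintype.prod_prod_type]
    refine prod_congr rfl fun r _ => ?_
    obtain ⟨h1, h2⟩ := hplaced r
    rw [Fintype.prod_bool, mul_comm]
    simp only [RHpart, RH, Matrix.of_apply, if_pos h1, if_pos h2, if_pos h1.1, if_pos h2.1]
    simp [p, walkEdge, trajectory]
  simp only [hprod]
  split_ifs with hcard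
  · exact sum_prod_sgn_le I p
  · obtain ⟨z, hz⟩ : ∃ z, ¬ Even #{i | walkEdge (trajectory AB (Sum.inl e₀.1))
        (trajectory AB (Sum.inr e₀.2)) i = z} := by
      by_contra! hc
      exact hcard (card_image_closedWalk_le _ _ hc)
    refine (sum_prod_sgn_eq_zero I p z ?_).le
    have hmem : ∀ v r, trajectory AB v r ∈ P v := by
      rintro (i | j) r
      · exact (hplaced r).1.2.1 i
      · exact (hplaced r).1.2.2 j
    have huniq : ∀ u v r r', trajectory AB u r = trajectory AB v r' → u = v := by
      intro u v r r' h
      by_contra huv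
      exact disjoint_left.1 (hP u v huv) (hmem u r) (h ▸ hmem v r')
    rw [← Nat.not_even_iff_odd]
    convert hz using 2
    obtain ⟨i₀, hi₀⟩ : (univ.filter fun i => walkEdge (trajectory AB (Sum.inl e₀.1))
        (trajectory AB (Sum.inr e₀.2)) i = z).Nonempty := by
      rw [nonempty_iff_ne_empty]
      intro h
      rw [h] at hz
      simp at hz
    have hi₀ := (mem_filter.1 hi₀).2
    have hedge : ∀ t, p t = z → t.2 = e₀ := by
      rintro ⟨i, e⟩ ht
      rw [← hi₀] at ht
      rcases Sym2.eq_iff.1 ht with ⟨h1, h2⟩ | ⟨h1, -⟩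
      · exact Prod.ext (Sum.inl.inj (huniq _ _ _ _ h1)) (Sum.inr.inj (huniq _ _ _ _ h2))
      · exact absurd (huniq _ _ _ _ h1) Sum.inl_ne_inr
    refine card_nbij' (fun t => t.1) (fun i => (i, e₀)) ?_ ?_ ?_ ?_
    · rintro ⟨i, e⟩ ht
      have ht := (mem_filter.1 ht).2
      obtain rfl : e = e₀ := hedge _ ht
      exact mem_filter.2 ⟨mem_univ _, ht⟩
    · intro i hi
      exact mem_filter.2 ⟨mem_product.2 ⟨mem_univ _, he₀⟩, (mem_filter.1 hi).2⟩
    · rintro ⟨i, e⟩ ht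
      exact Prod.ext rfl (hedge _ (mem_filter.1 ht).2).symm
    · intro i _
      rfl

lemma sum_opNorm_pow_le {n x y q m : ℕ} (hn : 1 ≤ n) (hq : 1 ≤ q) (E : Finset (Fin x × Fin y))
    (P : (Fin x ⊕ Fin y) → Finset (Fin n)) (hP : ∀ a b, a ≠ b → Disjoint (P a) (P b))
    (μ : Fin q → Fin x) (ν : Fin q → Fin y) (hμ : Function.Injective μ)
    (hν : Function.Injective ν) (hE : ∀ s, (μ s, ν s) ∈ E) :
    ∑ g : Sym2 (Fin n) → Bool, opNorm (RHpart E P g) ^ (2 * (m + 1)) ≤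
      ((n ^ (m + 2) * (m + 2) ^ (2 * (m + 1))) ^ q * (n ^ (m + 1)) ^ (x + y - 2 * q) : ℕ) *
        (Fintype.card (Sym2 (Fin n) → Bool) : ℝ) := by
  set F : Finset (Fin x ⊕ Fin y → Fin (m + 1) → Fin n) := {φ | ∀ s,
    #(univ.image (φ (Sum.inl (μ s))) ∪ univ.image (φ (Sum.inr (ν s)))) ≤ m + 2}
  have hF : #F ≤ (n ^ (m + 2) * (m + 2) ^ (2 * (m + 1))) ^ q *
      (n ^ (m + 1)) ^ (x + y - 2 * q) := by
    have := card_matched_trajectories_le (k := m + 1) (N := m + 2) hn (Sum.inl ∘ μ) (Sum.inr ∘ ν)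
      ((Sum.inl_injective.comp hμ).sumElim (Sum.inr_injective.comp hν) fun _ _ => Sum.inl_ne_inr)
    simpa using this
  calc ∑ g : Sym2 (Fin n) → Bool, opNorm (RHpart E P g) ^ (2 * (m + 1))
      ≤ ∑ g : Sym2 (Fin n) → Bool, ∑ AB : (Fin (m + 1) → SubsetsCard n x) ×
          (Fin (m + 1) → SubsetsCard n y),
          ∏ r, RHpart E P g (AB.1 r) (AB.2 r) * RHpart E P g (AB.1 (r + 1)) (AB.2 r) := by
        refine sum_le_sum fun g _ => ?_
        rw [Fintype.sum_prod_type, ← trace_mul_transpose_pow]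
        exact opNorm_pow_two_mul_le_trace _ m.succ_ne_zero
    _ ≤ ∑ AB : (Fin (m + 1) → SubsetsCard n x) × (Fin (m + 1) → SubsetsCard n y),
          if trajectory AB ∈ F then (Fintype.card (Sym2 (Fin n) → Bool) : ℝ) else 0 := by
        rw [sum_comm]
        refine sum_le_sum fun AB _ => ?_
        have h := fun s => sum_cycle_weight_le (m := m) E P hP AB _ (hE s)
        split_ifs with hAB
        · refine (h ⟨0, hq⟩).trans ?_
          split_ifs
          · exact le_rfl
          · positivity
        · obtain ⟨s, hs⟩ : ∃ s, ¬ #(univ.image (trajectory AB (Sum.inl (μ s))) ∪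
              univ.image (trajectory AB (Sum.inr (ν s)))) ≤ m + 2 := by
            simpa [F] using hAB
          simpa only [if_neg hs] using h s
    _ = #{AB : (Fin (m + 1) → SubsetsCard n x) × (Fin (m + 1) → SubsetsCard n y) |
          trajectory AB ∈ F} * (Fintype.card (Sym2 (Fin n) → Bool) : ℝ) := by
        rw [← sum_filter, sum_const, nsmul_eq_mul]
    _ ≤ _ := by
        gcongr
        refine (card_le_card_of_injOn trajectory (fun AB h => (mem_filter.1 h).2)
          trajectory_injective.injOn).trans hF

/-- Markov's inequality for even moments under the uniform measure. -/
lemma Pr_le_of_sum_pow_le {n : ℕ} (f : (Sym2 (Fin n) → Bool) → ℝ) {T C : ℝ} (hT : 0 < T) (k : ℕ)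
    (h : ∑ g, f g ^ (2 * k) ≤ C * (Fintype.card (Sym2 (Fin n) → Bool) : ℝ)) :
    Pr (fun g => T ≤ f g) ≤ C / T ^ (2 * k) := by
  classical
  have hΩ : (0 : ℝ) < Fintype.card (Sym2 (Fin n) → Bool) := by exact_mod_cast Fintype.card_pos
  have hcard : (#{g | T ≤ f g} : ℝ) * T ^ (2 * k) ≤ ∑ g, f g ^ (2 * k) := by
    calc (#{g | T ≤ f g} : ℝ) * T ^ (2 * k) = ∑ g with T ≤ f g, T ^ (2 * k) := by
          rw [sum_const, nsmul_eq_mul]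
      _ ≤ ∑ g with T ≤ f g, f g ^ (2 * k) := by
          refine sum_le_sum fun g hg => ?_
          exact pow_le_pow_left₀ hT.le (mem_filter.1 hg).2 _
      _ ≤ _ := sum_le_sum_of_subset_of_nonneg (filter_subset _ _) fun g _ _ =>
          (even_two_mul k).pow_nonneg _
  have hPr : Pr (fun g => T ≤ f g) =
      (#{g | T ≤ f g} : ℝ) / Fintype.card (Sym2 (Fin n) → Bool) := by
    unfold Pr
    congr!
  rw [hPr, div_le_div_iff₀ hΩ (by positivity)]
  exact hcard.trans h

/-- With `k = m + 1 ≥ L` where `ε = n ^ q * exp (-2 q L)`, the moment bound of order `2 k` is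
below `ε` times the `2 k`-th power of the threshold. -/
lemma moment_bound_le {n q t m : ℕ} {ε L : ℝ} (hn : 1 ≤ n) (hq : 1 ≤ q) (ht : 2 * q ≤ t)
    (hL : 0 ≤ L) (hmL : L ≤ m + 1) (hmL' : (m : ℝ) ≤ L)
    (hε : ε = n ^ q * Real.exp (-(2 * q * L))) :
    (((n ^ (m + 2) * (m + 2) ^ (2 * (m + 1))) ^ q * (n ^ (m + 1)) ^ (t - 2 * q) : ℕ) : ℝ) ≤
      ε * ((Real.exp 1 * t * (L + 1)) ^ q * (n : ℝ) ^ (((t : ℝ) - q) / 2)) ^ (2 * (m + 1)) := by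
  have hn0 : (0 : ℝ) < n := by exact_mod_cast hn
  have hrpow : ((n : ℝ) ^ (((t : ℝ) - q) / 2)) ^ (2 * (m + 1)) = (n : ℝ) ^ ((t - q) * (m + 1)) := by
    rw [← Real.rpow_natCast, ← Real.rpow_mul hn0.le, ← Real.rpow_natCast]
    congr 1
    push_cast [Nat.cast_sub (show q ≤ t by omega)]
    ring
  have hbase : ((m : ℝ) + 2) ≤ t * (L + 1) := by
    have h2 : (2 : ℝ) ≤ t := by exact_mod_cast (show 2 ≤ t by omega)
    nlinarith
  have hexp : Real.exp (-(2 * q * L)) * Real.exp 1 ^ (q * (2 * (m + 1))) ≥ 1 := by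
    rw [← Real.exp_nat_mul, ← Real.exp_add]
    refine Real.one_le_exp ?_
    push_cast
    nlinarith [mul_nonneg (Nat.cast_nonneg (α := ℝ) q) (sub_nonneg.2 hmL)]
  have hnexp : (n : ℝ) ^ ((m + 2) * q) * (n : ℝ) ^ ((m + 1) * (t - 2 * q)) =
      (n : ℝ) ^ q * (n : ℝ) ^ ((t - q) * (m + 1)) := by
    rw [← pow_add, ← pow_add]
    congr 1
    obtain ⟨c, rfl⟩ := Nat.exists_eq_add_of_le ht
    rw [Nat.add_sub_cancel_left, show 2 * q + c - q = q + c by omega]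
    ring
  calc _ = ((n : ℝ) ^ ((m + 2) * q) * (n : ℝ) ^ ((m + 1) * (t - 2 * q))) *
        ((m : ℝ) + 2) ^ (q * (2 * (m + 1))) := by
        push_cast
        rw [mul_pow, ← pow_mul, ← pow_mul, ← pow_mul]
        ring
    _ ≤ ((n : ℝ) ^ q * (n : ℝ) ^ ((t - q) * (m + 1))) * (t * (L + 1)) ^ (q * (2 * (m + 1))) := by
        rw [hnexp]
        gcongr
    _ ≤ ((n : ℝ) ^ q * (n : ℝ) ^ ((t - q) * (m + 1))) * (t * (L + 1)) ^ (q * (2 * (m + 1))) *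
        (Real.exp (-(2 * q * L)) * Real.exp 1 ^ (q * (2 * (m + 1)))) :=
        le_mul_of_one_le_right (by positivity) hexp
    _ = _ := by
        rw [mul_pow _ _ (2 * (m + 1)), hrpow, ← pow_mul, mul_assoc (Real.exp 1),
          mul_pow (Real.exp 1), hε]
        ring

theorem stmt9 (n x y q : ℕ) (hn : 1 ≤ n) (E : Finset (Fin x × Fin y))
    (hq : IsLeast {m | ∃ S : Finset (Fin x ⊕ Fin y), IsVertexCover E S ∧ S.card = m} q)
    (hq1 : 1 ≤ q)
    (P : (Fin x ⊕ Fin y) → Finset (Fin n))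
    (hPdisj : ∀ a b, a ≠ b → Disjoint (P a) (P b))
    (hPcov : ∀ v : Fin n, ∃ a, v ∈ P a)
    (ε : ℝ) (hε0 : 0 < ε) (hε1 : ε < 1) :
    Pr (fun g : Sym2 (Fin n) → Bool =>
        (Real.exp 1 * ((x + y : ℕ) : ℝ) *
            (Real.log ((n : ℝ) ^ q / ε) / (2 * (q : ℝ)) + 1)) ^ q *
          (n : ℝ) ^ ((((x + y : ℕ) : ℝ) - (q : ℝ)) / 2)
        ≤ opNorm (RHpart E P g)) ≤ ε := by
  obtain ⟨μ, ν, hμ, hν, hE⟩ := exists_matching_of_isLeast_vertexCover E hq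
  have hn0 : (0 : ℝ) < n := by exact_mod_cast hn
  have hq0 : (0 : ℝ) < q := by exact_mod_cast hq1
  have ht : 2 * q ≤ x + y := by
    have h1 := Fintype.card_le_of_injective μ hμ
    have h2 := Fintype.card_le_of_injective ν hν
    simp only [Fintype.card_fin] at h1 h2
    omega
  have ht0 : (0 : ℝ) < ((x + y : ℕ) : ℝ) := by exact_mod_cast (show 0 < x + y by omega)
  set L : ℝ := Real.log ((n : ℝ) ^ q / ε) / (2 * (q : ℝ)) with hL
  have hL0 : 0 < L := by
    have h1 : (1 : ℝ) ≤ (n : ℝ) ^ q := one_le_pow₀ (by exact_mod_cast hn)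
    exact div_pos (Real.log_pos ((one_lt_div hε0).2 (by linarith))) (by positivity)
  have hε : ε = n ^ q * Real.exp (-(2 * q * L)) := by
    have h1 : 2 * q * L = Real.log ((n : ℝ) ^ q / ε) := by
      rw [hL]
      field_simp
    rw [h1, Real.exp_neg, Real.exp_log (by positivity)]
    field_simp
  have hT : 0 < (Real.exp 1 * ((x + y : ℕ) : ℝ) * (L + 1)) ^ q *
      (n : ℝ) ^ ((((x + y : ℕ) : ℝ) - (q : ℝ)) / 2) := by positivity
  refine (Pr_le_of_sum_pow_le _ hT (⌊L⌋₊ + 1)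
    (sum_opNorm_pow_le hn hq1 E P hPdisj μ ν hμ hν hE)).trans ?_
  rw [div_le_iff₀ (by positivity)]
  exact moment_bound_le hn hq1 ht hL0.le (Nat.lt_floor_add_one L).le (Nat.floor_le hL0.le) hε
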